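/- Under the right-spinor Dirac setup, for each k ∈ {1,2,3}: ∂₀ j^k + ∂_k j⁰ + 2·Σ_{l,n=1}^{3} ε_{kln}·T_l^n = 0 on ℝ⁴, where ε is the standard Levi-Civita symbol with ε₁₂₃ = 1. -/

import Mathlib

open Matrix

noncomputable section

/-- The space algebra `Cl(3)` represented as `M₂(ℂ)`. -/
abbrev M2 : Type := Matrix (Fin 2) (Fin 2) ℂ

/-- Spacetime `ℝ⁴`. -/
abbrev R4 : Type := Fin 4 → ℝ

/-- Basis paravectors: `e 0 = 1` and the Pauli matrices. -/
def e : Fin 4 → M2 :=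
  ![1, !![0, 1; 1, 0], !![0, -Complex.I; Complex.I, 0], !![1, 0; 0, -1]]

/-- Dual basis paravectors: `edual 0 = 1` and `edual k = - e k` for `k = 1,2,3`. -/
def edual : Fin 4 → M2 :=
  ![1, -e 1, -e 2, -e 3]

/-- The grade automorphism `M̂ = (adj M)†`. -/
def gradeAut (M : M2) : M2 := (M.adjugate)ᴴ

/-- The projector `P = ½(1+e₃)`. -/
def P : M2 := !![1, 0; 0, 0]

/-- The projector `P̄ = ½(1-e₃)`. -/
def Pbar : M2 := !![0, 0; 0, 1]

/-- Partial derivative `∂_μ` of a complex-valued function on `ℝ⁴`. -/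
def pdC (μ : Fin 4) (f : R4 → ℂ) (x : R4) : ℂ := fderiv ℝ f x (Pi.single μ 1)

/-- Partial derivative `∂_μ` of a real-valued function on `ℝ⁴`. -/
def pdR (μ : Fin 4) (f : R4 → ℝ) (x : R4) : ℝ := fderiv ℝ f x (Pi.single μ 1)

/-- Entrywise partial derivative `∂_μ` of an `M₂(ℂ)`-valued function on `ℝ⁴`. -/
def pdM (μ : Fin 4) (f : R4 → M2) (x : R4) : M2 :=
  Matrix.of fun i j => pdC μ (fun y => f y i j) x

/-- Components of the chiral current `𝔧 = φ·P̄·φ†`: `j^μ = ½ tr(𝔧 * e μ)`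
(note `e 0 = 1`). -/
def jComp (φ : R4 → M2) (μ : Fin 4) (x : R4) : ℂ :=
  (1/2) * (φ x * Pbar * (φ x)ᴴ * e μ).trace

/-- Tétrode's energy-momentum tensor `T_ν^μ`. -/
def TComp (Γ : Fin 4 → R4 → ℝ) (φ : R4 → M2) (ν μ : Fin 4) (x : R4) : ℂ :=
  -(Complex.I / 4) *
      (edual μ *
        (pdM ν (fun y => gradeAut (φ y)) x * P * (φ x).adjugate
          - gradeAut (φ x) * P * pdM ν (fun y => (φ y).adjugate) x)).trace
    + (Γ ν x : ℂ) * jComp φ μ x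

/-- The Levi-Civita symbol on `{1,2,3}` (indexed by `Fin 3`), with `ε 0 1 2 = 1`. -/
def eps : Fin 3 → Fin 3 → Fin 3 → ℝ := fun i j k =>
  if (i, j, k) = (0, 1, 2) ∨ (i, j, k) = (1, 2, 0) ∨ (i, j, k) = (2, 0, 1) then 1
  else if (i, j, k) = (2, 1, 0) ∨ (i, j, k) = (1, 0, 2) ∨ (i, j, k) = (0, 2, 1) then -1
  else 0

theorem pdC_add' (μ : Fin 4) (f g : R4 → ℂ) (x : R4) (hf : Differentiable ℝ f)
    (hg : Differentiable ℝ g) :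
    pdC μ (fun y => f y + g y) x = pdC μ f x + pdC μ g x := by
  unfold pdC
  rw [fderiv_fun_add (hf x) (hg x)]; rfl

theorem pdC_neg' (μ : Fin 4) (f : R4 → ℂ) (x : R4) :
    pdC μ (fun y => - f y) x = - pdC μ f x := by
  unfold pdC
  rw [fderiv_fun_neg]; rfl

theorem pdC_zero' (μ : Fin 4) (x : R4) : pdC μ (fun _ => (0 : ℂ)) x = 0 := by
  unfold pdC
  simp

theorem pdC_cmul' (μ : Fin 4) (c : ℂ) (f : R4 → ℂ) (x : R4) (hf : Differentiable ℝ f) :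
    pdC μ (fun y => c * f y) x = c * pdC μ f x := by
  unfold pdC
  rw [fderiv_const_mul (hf x)]; rfl

theorem pdC_mul' (μ : Fin 4) (f g : R4 → ℂ) (x : R4) (hf : Differentiable ℝ f)
    (hg : Differentiable ℝ g) :
    pdC μ (fun y => f y * g y) x = f x * pdC μ g x + g x * pdC μ f x := by
  unfold pdC
  rw [fderiv_fun_mul (hf x) (hg x)]; simp

theorem pdC_star' (μ : Fin 4) (f : R4 → ℂ) (x : R4) (hf : Differentiable ℝ f) :
    pdC μ (fun y => (starRingEnd ℂ) (f y)) x = (starRingEnd ℂ) (pdC μ f x) := by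
  unfold pdC
  have h := ((Complex.conjCLE : ℂ →L[ℝ] ℂ).hasFDerivAt.comp x (hf x).hasFDerivAt).fderiv
  have h2 : (fun y => (starRingEnd ℂ) (f y)) = (Complex.conjCLE : ℂ →L[ℝ] ℂ) ∘ f := by
    funext y; simp
  rw [h2, h]; simp

theorem gradeAut_eq (M : M2) : gradeAut M =
    !![(starRingEnd ℂ) (M 1 1), -(starRingEnd ℂ) (M 1 0);
       -(starRingEnd ℂ) (M 0 1), (starRingEnd ℂ) (M 0 0)] := by
  unfold gradeAut
  rw [Matrix.adjugate_fin_two]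
  ext i j
  fin_cases i <;> fin_cases j <;> simp

/-- Evolution equation for the spatial components of the chiral current. -/
theorem chiral_current_evolution
    (Γ : Fin 4 → R4 → ℝ) (hΓ : ∀ μ, ContDiff ℝ (⊤ : ℕ∞) (Γ μ))
    (φ : R4 → M2) (hφ : ∀ i j, ContDiff ℝ (⊤ : ℕ∞) (fun x => φ x i j))
    (hDirac : ∀ x : R4,
      (∑ μ : Fin 4, edual μ * pdM μ (fun y => gradeAut (φ y) * P) x)
        + Complex.I • ((∑ μ : Fin 4, (Γ μ x : ℂ) • edual μ) * (gradeAut (φ x) * P)) = 0) :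
    ∀ x : R4, ∀ k : Fin 3,
      pdC 0 (fun y => jComp φ k.succ y) x + pdC k.succ (fun y => jComp φ 0 y) x
        + 2 * ∑ l : Fin 3, ∑ n : Fin 3,
            (eps k l n : ℂ) * TComp Γ φ l.succ n.succ x = 0 := by
  intro x k
  have dif : ∀ i j, Differentiable ℝ (fun x => φ x i j) := fun i j =>
    (hφ i j).differentiable (by simp)
  have difs : ∀ i j, Differentiable ℝ (fun x => (starRingEnd ℂ) (φ x i j)) := fun i j => by
    have h2 : (fun y => (starRingEnd ℂ) (φ y i j))
        = (Complex.conjCLE : ℂ →L[ℝ] ℂ) ∘ (fun y => φ y i j) := by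
      funext y; simp
    rw [h2]
    exact (Complex.conjCLE : ℂ →L[ℝ] ℂ).differentiable.comp (dif i j)
  have hs : ∀ μ i j, pdC μ (fun y => (starRingEnd ℂ) (φ y i j)) x
      = (starRingEnd ℂ) (pdC μ (fun y => φ y i j) x) := fun μ i j => pdC_star' μ _ x (dif i j)
  have hm : ∀ μ i j, pdC μ (fun y => φ y i 1 * (starRingEnd ℂ) (φ y j 1)) x
      = φ x i 1 * (starRingEnd ℂ) (pdC μ (fun y => φ y j 1) x)
        + (starRingEnd ℂ) (φ x j 1) * pdC μ (fun y => φ y i 1) x := fun μ i j => by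
    rw [pdC_mul' μ _ _ x (dif i 1) (difs j 1), hs]
  have difm : ∀ i j, Differentiable ℝ (fun y => φ y i 1 * (starRingEnd ℂ) (φ y j 1)) :=
    fun i j => (dif i 1).mul (difs j 1)
  have hj : ∀ μ ν, pdC μ (fun y => jComp φ ν y) x = (1/2) *
      (e ν 0 0 * pdC μ (fun y => φ y 0 1 * (starRingEnd ℂ) (φ y 0 1)) x
      + e ν 1 0 * pdC μ (fun y => φ y 0 1 * (starRingEnd ℂ) (φ y 1 1)) x
      + e ν 0 1 * pdC μ (fun y => φ y 1 1 * (starRingEnd ℂ) (φ y 0 1)) x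
      + e ν 1 1 * pdC μ (fun y => φ y 1 1 * (starRingEnd ℂ) (φ y 1 1)) x) := by
    intro μ ν
    have h : (fun y => jComp φ ν y) = fun y => (1/2) *
      (e ν 0 0 * (φ y 0 1 * (starRingEnd ℂ) (φ y 0 1))
      + e ν 1 0 * (φ y 0 1 * (starRingEnd ℂ) (φ y 1 1))
      + e ν 0 1 * (φ y 1 1 * (starRingEnd ℂ) (φ y 0 1))
      + e ν 1 1 * (φ y 1 1 * (starRingEnd ℂ) (φ y 1 1))) := by
      funext y
      simp [jComp, Pbar, Matrix.trace, Matrix.mul_apply, Fin.sum_univ_two]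
      ring
    have d1 : ∀ c i j, Differentiable ℝ (fun y => c * (φ y i 1 * (starRingEnd ℂ) (φ y j 1))) :=
      fun c i j => (difm i j).const_mul c
    have a4 := d1 (e ν 1 1) 1 1
    have a3 := d1 (e ν 0 1) 1 0
    have a2 := d1 (e ν 1 0) 0 1
    have a1 := d1 (e ν 0 0) 0 0
    have b2 := a1.fun_add a2
    have b3 := b2.fun_add a3
    have b4 := b3.fun_add a4
    rw [h, pdC_cmul' _ _ _ _ b4, pdC_add' _ _ _ _ b3 a4, pdC_add' _ _ _ _ b2 a3,
      pdC_add' _ _ _ _ a1 a2, pdC_cmul' _ _ _ _ (difm 0 0), pdC_cmul' _ _ _ _ (difm 0 1),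
      pdC_cmul' _ _ _ _ (difm 1 0), pdC_cmul' _ _ _ _ (difm 1 1)]
  have m1 : ∀ μ, pdM μ (fun y => gradeAut (φ y) * P) x =
      !![(starRingEnd ℂ) (pdC μ (fun y => φ y 1 1) x), 0;
        -(starRingEnd ℂ) (pdC μ (fun y => φ y 0 1) x), 0] := by
    intro μ
    ext i j
    fin_cases i <;> fin_cases j <;>
    simp [pdM, gradeAut_eq, P, Matrix.mul_apply, Fin.sum_univ_two, pdC_neg', pdC_zero', hs]
  have m2 : ∀ μ, pdM μ (fun y => gradeAut (φ y)) x =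
      !![(starRingEnd ℂ) (pdC μ (fun y => φ y 1 1) x), -(starRingEnd ℂ) (pdC μ (fun y => φ y 1 0) x);
        -(starRingEnd ℂ) (pdC μ (fun y => φ y 0 1) x), (starRingEnd ℂ) (pdC μ (fun y => φ y 0 0) x)] := by
    intro μ
    ext i j
    fin_cases i <;> fin_cases j <;>
    simp [pdM, gradeAut_eq, pdC_neg', hs]
  have m3 : ∀ μ, pdM μ (fun y => (φ y).adjugate) x =
      !![pdC μ (fun y => φ y 1 1) x, -pdC μ (fun y => φ y 0 1) x;
        -pdC μ (fun y => φ y 1 0) x, pdC μ (fun y => φ y 0 0) x] := by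
    intro μ
    ext i j
    fin_cases i <;> fin_cases j <;>
    simp [pdM, Matrix.adjugate_fin_two, pdC_neg']
  have hD := hDirac x
  simp only [m1] at hD
  have E1 := congrFun (congrFun hD 0) 0
  have E2 := congrFun (congrFun hD 1) 0
  simp [Fin.sum_univ_four, edual, e, gradeAut_eq, P, Matrix.mul_apply, Fin.sum_univ_two] at E1 E2
  have F1 := congrArg (starRingEnd ℂ) E1
  have F2 := congrArg (starRingEnd ℂ) E2
  simp at F1 F2
  have hI := Complex.I_mul_I
  simp only [hj]
  simp only [hm, TComp, m2, m3, jComp]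
  clear hj hm m1 m2 m3 hD hDirac hs dif difs difm hφ hΓ
  fin_cases k <;>
  simp [Fin.sum_univ_three, eps, edual, e, gradeAut_eq, P, Pbar,
    Matrix.trace, Matrix.mul_apply, Fin.sum_univ_two, Matrix.adjugate_fin_two]
  all_goals
    generalize pdC 0 (fun y => φ y 0 1) x = b0 at *
    generalize pdC 1 (fun y => φ y 0 1) x = b1 at *
    generalize pdC 2 (fun y => φ y 0 1) x = b2 at *
    generalize pdC 3 (fun y => φ y 0 1) x = b3 at *
    generalize pdC 0 (fun y => φ y 1 1) x = d0 at *
    generalize pdC 1 (fun y => φ y 1 1) x = d1 at *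
    generalize pdC 2 (fun y => φ y 1 1) x = d2 at *
    generalize pdC 3 (fun y => φ y 1 1) x = d3 at *
    generalize φ x 0 1 = b at *
    generalize φ x 1 1 = d at *
    simp only [starRingEnd_apply] at *
    generalize star b = b' at *
    generalize star d = d' at *
    generalize star b0 = b0' at *
    generalize star b1 = b1' at *
    generalize star b2 = b2' at *
    generalize star b3 = b3' at *
    generalize star d0 = d0' at *
    generalize star d1 = d1' at *
    generalize star d2 = d2' at *
    generalize star d3 = d3' at *
    generalize (Γ 0 x : ℂ) = g0 at *
    generalize (Γ 1 x : ℂ) = g1 at *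
    generalize (Γ 2 x : ℂ) = g2 at *
    generalize (Γ 3 x : ℂ) = g3 at *
    generalize Complex.I = w at *
  · linear_combination (norm := skip) -(1/2) * (d * E2 - b * E1 + d' * F2 - b' * F1)
    clear E1 E2 F1 F2
    grind
  · linear_combination (norm := skip) -(1/2) * (-w * d * E2 - w * b * E1 + w * d' * F2 + w * b' * F1)
    clear E1 E2 F1 F2
    grind
  · linear_combination (norm := skip) -(1/2) * (d * E1 + b * E2 + d' * F1 + b' * F2)
    clear E1 E2 F1 F2
    grind
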